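/- Let m and c be positive integers with m² + (m+1)² = c². Then there exists k ≥ 0 such that c = aₖ and m = mₖ, where (aₖ) is defined by a₀ = 1, a₁ = 5, aₖ₊₁ = 6aₖ − aₖ₋₁, and mₖ = (dₖ − 1)/2 with d₀ = 1, d₁ = 7, dₖ₊₁ = 6dₖ − dₖ₋₁. In particular, the sequence (mₖ, mₖ+1, aₖ), k ≥ 1, enumerates all Pythagorean triples whose legs differ by one. -/

import Mathlib

theorem stmt_17 (m c : ℕ) (hm : 0 < m) (hc : 0 < c)
    (hpyth : m ^ 2 + (m + 1) ^ 2 = c ^ 2)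
    (a d : ℕ → ℤ)
    (ha0 : a 0 = 1) (ha1 : a 1 = 5)
    (harec : ∀ k : ℕ, a (k + 2) = 6 * a (k + 1) - a k)
    (hd0 : d 0 = 1) (hd1 : d 1 = 7)
    (hdrec : ∀ k : ℕ, d (k + 2) = 6 * d (k + 1) - d k) :
    ∃ k : ℕ, 1 ≤ k ∧ (c : ℤ) = a k ∧ 2 * (m : ℤ) = d k - 1 := by
  have step : ∀ k, a (k + 1) = 3 * a k + 2 * d k ∧ d (k + 1) = 3 * d k + 4 * a k := by
    intro k
    induction k with
    | zero => simp [ha0, ha1, hd0, hd1]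
    | succ k ih =>
      have h1 := harec k
      have h2 := hdrec k
      obtain ⟨h3, h4⟩ := ih
      constructor
      · show a (k + 2) = _
        linarith
      · show d (k + 2) = _
        linarith
  have main : ∀ n : ℕ, ∀ x y : ℤ, 0 < x → 0 < y → x ^ 2 + 1 = 2 * y ^ 2 → y ≤ n →
      ∃ k, y = a k ∧ x = d k := by
    intro n
    induction n with
    | zero => intro x y _ hy _ hn; push_cast at hn; omega
    | succ n ih =>
      intro x y hx hy h hn
      push_cast at hn
      by_cases h1 : y = 1
      · subst h1
        exact ⟨0, ha0.symm, by rw [hd0]; nlinarith⟩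
      by_cases h2 : y = 2
      · subst h2
        exfalso
        have : x < 3 := by nlinarith
        interval_cases x <;> omega
      have h3 : 3 ≤ y := by omega
      have hx' : 0 < 3 * x - 4 * y := by
        by_contra hcon
        have : 3 * x ≤ 4 * y := by omega
        nlinarith
      have hy' : 0 < 3 * y - 2 * x := by
        by_contra hcon
        have : 3 * y ≤ 2 * x := by omega
        nlinarith
      have hlt : y < x := by
        by_contra hcon
        have : x ≤ y := by omega
        nlinarith
      obtain ⟨k, hk1, hk2⟩ := ih (3 * x - 4 * y) (3 * y - 2 * x) hx' hy' (by linarith) (by omega)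
      obtain ⟨s1, s2⟩ := step k
      exact ⟨k + 1, by linarith, by linarith⟩
  have hz : (m : ℤ) ^ 2 + (m + 1) ^ 2 = c ^ 2 := by exact_mod_cast hpyth
  obtain ⟨k, hk1, hk2⟩ := main c (2 * m + 1) c (by positivity) (by exact_mod_cast hc)
    (by linarith) le_rfl
  refine ⟨k, ?_, hk1, by linarith⟩
  rcases Nat.eq_zero_or_pos k with h0 | h0
  · subst h0
    rw [hd0] at hk2
    omega
  · exact h0
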